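/- In the edge graph of the regular dodecahedron, the set of vertices can be partitioned considerations aside: there exist exactly 10 four-element subsets of vertices in which any two distinct vertices are at graph distance exactly 3 from each other. -/

import Mathlib

/-- Edge list of the dodecahedral graph, realized as the generalized Petersen graph
GP(10,2): outer 10-cycle `0,…,9`, spokes `i — 10+i`, and inner vertices `10,…,19`
joined in steps of two (`10+i — 10+((i+2) mod 10)`), giving the 3-regular planar
graph on 20 vertices with 30 edges and 12 pentagonal faces. -/
def dodecEdges : List (ℕ × ℕ) :=
  (List.range 10).map (fun i => (i, (i + 1) % 10)) ++
  (List.range 10).map (fun i => (i, 10 + i)) ++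
  (List.range 10).map (fun i => (10 + i, 10 + (i + 2) % 10))

/-- The edge graph of the regular dodecahedron. -/
def dodecGraph : SimpleGraph (Fin 20) :=
  SimpleGraph.fromRel (fun a b => ((a : ℕ), (b : ℕ)) ∈ dodecEdges)

namespace SimpleGraph

variable {V : Type*} (G : SimpleGraph V)

/-- Two vertices are at distance three iff they are joined by a walk of length three and by no
shorter walk. -/
theorem dist_eq_three_iff (x y : V) :
    G.dist x y = 3 ↔ x ≠ y ∧ ¬ G.Adj x y ∧ (∀ z, G.Adj x z → ¬ G.Adj z y) ∧
      ∃ z, G.Adj x z ∧ ∃ w, G.Adj z w ∧ G.Adj w y := by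
  constructor
  · intro h
    refine ⟨?_, ?_, ?_, ?_⟩
    · rintro rfl
      simp at h
    · intro hxy
      have := dist_le hxy.toWalk
      simp [h] at this
    · intro z hxz hzy
      have := dist_le (Walk.cons hxz hzy.toWalk)
      simp [h] at this
    · obtain ⟨p, hp⟩ := (Reachable.of_dist_ne_zero
        (by omega : G.dist x y ≠ 0)).exists_walk_length_eq_dist
      rw [h] at hp
      match p, hp with
      | .cons hxz (.cons hzw (.cons hwy .nil)), _ => exact ⟨_, hxz, _, hzw, hwy⟩
  · rintro ⟨hne, hadj, htwo, z, hxz, w, hzw, hwy⟩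
    have hle := dist_le (Walk.cons hxz (Walk.cons hzw hwy.toWalk))
    obtain ⟨p, hp⟩ :=
      (Walk.cons hxz (Walk.cons hzw hwy.toWalk)).reachable.exists_walk_length_eq_dist
    simp only [Walk.length_cons, Walk.length_nil] at hle
    rw [← hp] at hle ⊢
    match p, hle with
    | .nil, _ => exact absurd rfl hne
    | .cons h .nil, _ => exact absurd h hadj
    | .cons h (.cons h' .nil), _ => exact absurd h' (htwo _ h)
    | .cons _ (.cons _ (.cons _ .nil)), _ => rfl

end SimpleGraph

instance : DecidableRel dodecGraph.Adj := fun a b =>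
  decidable_of_iff _ (SimpleGraph.fromRel_adj _ a b).symm

/-- The distance-three relation of `dodecGraph`, read off from the rotation class of a pair:
which of the two vertices are outer, and their difference modulo ten. -/
def dodecFar (x y : Fin 20) : Bool :=
  let d := (x.val + 10 - y.val % 10) % 10
  match x.val.blt 10, y.val.blt 10 with
  | true, true => d == 3 || d == 7
  | false, false => d == 1 || d == 9
  | _, _ => d == 3 || d == 4 || d == 6 || d == 7

theorem dodecGraph_dist_eq_three_iff (x y : Fin 20) :
    dodecGraph.dist x y = 3 ↔ dodecFar x y = true := by
  rw [SimpleGraph.dist_eq_three_iff]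
  revert x y
  decide +kernel

/-- The ten rotations of the quadruple `{0, 3, 16, 17}`. -/
def dodecTetrahedron (i : Fin 10) : Finset (Fin 20) :=
  {i.castAdd 10, (i + 3).castAdd 10, (i + 6).natAdd 10, (i + 7).natAdd 10}

theorem dodecTetrahedron_injective : Function.Injective dodecTetrahedron := by
  decide +kernel

theorem card_dodecTetrahedron (i : Fin 10) : (dodecTetrahedron i).card = 4 := by
  revert i
  decide +kernel

theorem dodecFar_of_mem_dodecTetrahedron : ∀ i, ∀ x ∈ dodecTetrahedron i,
    ∀ y ∈ dodecTetrahedron i, x ≠ y → dodecFar x y = true := by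
  decide +kernel

theorem exists_mem_dodecTetrahedron_of_dodecFar : ∀ a b, dodecFar a b = true →
    ∀ c, dodecFar a c = true → dodecFar b c = true →
    ∀ d, dodecFar a d = true → dodecFar b d = true → dodecFar c d = true →
      ∃ i, a ∈ dodecTetrahedron i ∧ b ∈ dodecTetrahedron i ∧
        c ∈ dodecTetrahedron i ∧ d ∈ dodecTetrahedron i := by
  decide +kernel

/-- in the edge graph of the regular dodecahedron there are exactly
ten 4-element subsets of vertices in which any two distinct vertices are at graph
distance exactly 3 from each other. -/
theorem dodecahedron_ten_tetrahedra :
    {s : Finset (Fin 20) | s.card = 4 ∧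
      ∀ x ∈ s, ∀ y ∈ s, x ≠ y → dodecGraph.dist x y = 3}.ncard = 10 := by
  suffices h : {s : Finset (Fin 20) | s.card = 4 ∧
      ∀ x ∈ s, ∀ y ∈ s, x ≠ y → dodecGraph.dist x y = 3} = Set.range dodecTetrahedron by
    rw [h, ← Set.image_univ, Set.ncard_image_of_injective _ dodecTetrahedron_injective]
    simp
  ext s
  simp only [Set.mem_ofPred_eq, Set.mem_range, dodecGraph_dist_eq_three_iff]
  constructor
  · rintro ⟨hcard, h⟩
    obtain ⟨a, b, c, d, hab, hac, had, hbc, hbd, hcd, rfl⟩ := Finset.card_eq_four.mp hcard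
    obtain ⟨i, ha, hb, hc, hd⟩ := exists_mem_dodecTetrahedron_of_dodecFar
      a b (h a (by simp) b (by simp) hab)
      c (h a (by simp) c (by simp) hac) (h b (by simp) c (by simp) hbc)
      d (h a (by simp) d (by simp) had) (h b (by simp) d (by simp) hbd)
      (h c (by simp) d (by simp) hcd)
    refine ⟨i, (Finset.eq_of_subset_of_card_le ?_ ?_).symm⟩
    · simp [Finset.insert_subset_iff, ha, hb, hc, hd]
    · rw [hcard, card_dodecTetrahedron]
  · rintro ⟨i, rfl⟩
    exact ⟨card_dodecTetrahedron i, dodecFar_of_mem_dodecTetrahedron i⟩
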